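/- arXiv:2505.24321 — 4 statements merged into one kernel-verified Lean document; each statement's English description precedes it below -/
import Mathlib

section
/- For every ε ∈ (0,1] and every deterministic online algorithm for chores, there exists a chores instance with two agents having additive bi-valued cost functions such that the final complete allocation A^t produced by the algorithm is not (2−ε)-EF1; and for every ε ∈ (0,1/2] and every deterministic online algorithm for chores, there exists a (possibly different) such instance whose final complete allocation is not (3/2−ε)-MMS. In particular, for two agents with additive bi-valued cost functions no deterministic online algorithm can compute a complete allocation that is (2−ε)-EF1 or (3/2−ε)-MMS for any ε > 0. -/
open Finset

namespace OnlineFair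

/-- The valuation/cost profile restricted to the items `0, …, k` that have arrived
by the end of (0-indexed) round `k`: an online algorithm's decision at round `k`
may depend only on this restriction. -/
def restrictVal {n : ℕ} (v : Fin n → Finset ℕ → ℝ) (k : ℕ) : Fin n → Finset ℕ → ℝ :=
  fun i S => v i (S ∩ Finset.range (k + 1))

/-- A deterministic online algorithm for goods with `n` agents: at each round it sees
only the valuations restricted to the arrived items, and either assigns the newly
arrived item to an agent or discards it (`none`). -/
abbrev GoodsAlg (n : ℕ) : Type := ℕ → (Fin n → Finset ℕ → ℝ) → Option (Fin n)

/-- The allocation produced by a goods algorithm after `k` rounds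
(the arrived items are `0, …, k-1`; item `k-1` arrived in the last round). -/
def runGoods {n : ℕ} (alg : GoodsAlg n) (v : Fin n → Finset ℕ → ℝ) : ℕ → Fin n → Finset ℕ
  | 0 => fun _ => ∅
  | k + 1 => fun i =>
      match alg k (restrictVal v k) with
      | some j => if i = j then insert k (runGoods alg v k i) else runGoods alg v k i
      | none => runGoods alg v k i

/-- A deterministic online algorithm for chores with `n` agents: every arriving chore
must be assigned to some agent, based only on the costs restricted to arrived chores. -/
abbrev ChoresAlg (n : ℕ) : Type := ℕ → (Fin n → Finset ℕ → ℝ) → Fin n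

/-- The (complete) allocation produced by a chores algorithm after `k` rounds. -/
def runChores {n : ℕ} (alg : ChoresAlg n) (c : Fin n → Finset ℕ → ℝ) : ℕ → Fin n → Finset ℕ
  | 0 => fun _ => ∅
  | k + 1 => fun i =>
      if i = alg k (restrictVal c k) then insert k (runChores alg c k i)
      else runChores alg c k i

/-- A normalized monotone (hence nonnegative) valuation / cost function. -/
def IsVal (v : Finset ℕ → ℝ) : Prop :=
  v ∅ = 0 ∧ ∀ S T : Finset ℕ, S ⊆ T → v S ≤ v T

/-- Additive set function. -/
def AdditiveVal (v : Finset ℕ → ℝ) : Prop :=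
  ∀ S : Finset ℕ, v S = ∑ e ∈ S, v {e}

/-- Tri-valued singleton values: `v {e} ∈ {a, b, z}` with `0 < a ≤ b ≤ z`. -/
def TriValuedVal (v : Finset ℕ → ℝ) : Prop :=
  ∃ a b z : ℝ, 0 < a ∧ a ≤ b ∧ b ≤ z ∧ ∀ e : ℕ, v {e} = a ∨ v {e} = b ∨ v {e} = z

/-- Bi-valued singleton values: `v {e} ∈ {a, b}` with `0 < a ≤ b`. -/
def BiValuedVal (v : Finset ℕ → ℝ) : Prop :=
  ∃ a b : ℝ, 0 < a ∧ a ≤ b ∧ ∀ e : ℕ, v {e} = a ∨ v {e} = b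

/-- Binary singleton values: `v {e} ∈ {0, 1}`. -/
def BinaryVal (v : Finset ℕ → ℝ) : Prop :=
  ∀ e : ℕ, v {e} = 0 ∨ v {e} = 1

def Submodular (v : Finset ℕ → ℝ) : Prop :=
  ∀ X Y : Finset ℕ, v (X ∪ Y) + v (X ∩ Y) ≤ v X + v Y

def Supermodular (v : Finset ℕ → ℝ) : Prop :=
  ∀ X Y : Finset ℕ, v X + v Y ≤ v (X ∪ Y) + v (X ∩ Y)

/-- Every marginal value `v (X ∪ {e}) - v X` lies in `{0, 1}`. -/
def BinaryMarginals (v : Finset ℕ → ℝ) : Prop :=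
  ∀ (X : Finset ℕ) (e : ℕ), v (insert e X) = v X ∨ v (insert e X) = v X + 1

/-- Submodular binary valuation (equivalently, a matroid rank function). -/
def SubmodularBinary (v : Finset ℕ → ℝ) : Prop :=
  IsVal v ∧ Submodular v ∧ BinaryMarginals v

/-- Supermodular binary cost function. -/
def SupermodularBinary (v : Finset ℕ → ℝ) : Prop :=
  IsVal v ∧ Supermodular v ∧ BinaryMarginals v

/-- `B` is an allocation of (part of) the item set `T`:
pairwise disjoint bundles of items from `T`. -/
def IsAlloc (n : ℕ) (T : Finset ℕ) (B : Fin n → Finset ℕ) : Prop :=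
  (∀ i, B i ⊆ T) ∧ ∀ i j, i ≠ j → Disjoint (B i) (B j)

/-- Every item of `T` is assigned to some agent. -/
def Complete (n : ℕ) (T : Finset ℕ) (A : Fin n → Finset ℕ) : Prop :=
  ∀ e ∈ T, ∃ i, e ∈ A i

/-- `B` is a partition of `T` into `n` (possibly empty) bundles. -/
def IsPartition (n : ℕ) (T : Finset ℕ) (B : Fin n → Finset ℕ) : Prop :=
  IsAlloc n T B ∧ Complete n T B

/-- Non-wastefulness of the allocation `A` of the arrived goods `T`:
every allocated good has strictly positive marginal value inside its bundle, and
every discarded good has zero marginal value with respect to every agent's bundle. -/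
def NonWasteful (n : ℕ) (v : Fin n → Finset ℕ → ℝ) (T : Finset ℕ)
    (A : Fin n → Finset ℕ) : Prop :=
  (∀ i, ∀ e ∈ A i, v i ((A i).erase e) < v i (A i)) ∧
  (∀ i, ∀ e ∈ T, (∀ j, e ∉ A j) → v i (insert e (A i)) = v i (A i))

/-- `α`-EF1 for goods. -/
def EF1Goods (n : ℕ) (α : ℝ) (v : Fin n → Finset ℕ → ℝ) (A : Fin n → Finset ℕ) : Prop :=
  ∀ i j : Fin n, (A j).Nonempty → ∃ e ∈ A j, α * v i ((A j).erase e) ≤ v i (A i)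

/-- `α`-MMS for goods: for every `n`-partition `B` of the arrived items, agent `i`'s
value is at least `α` times the minimum bundle value of `B` (i.e. at least `α` times
the value of some bundle of `B`); this says `v i (A i) ≥ α · MMS_i`. -/
def MMSGoods (n : ℕ) (α : ℝ) (v : Fin n → Finset ℕ → ℝ) (T : Finset ℕ)
    (A : Fin n → Finset ℕ) : Prop :=
  ∀ i : Fin n, ∀ B : Fin n → Finset ℕ, IsPartition n T B → ∃ j, α * v i (B j) ≤ v i (A i)

/-- `α`-max-USW: the utilitarian social welfare of `A` is at least `α` times that of
any allocation of the arrived items. -/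
def MaxUSW (n : ℕ) (α : ℝ) (v : Fin n → Finset ℕ → ℝ) (T : Finset ℕ)
    (A : Fin n → Finset ℕ) : Prop :=
  ∀ B : Fin n → Finset ℕ, IsAlloc n T B → α * ∑ i, v i (B i) ≤ ∑ i, v i (A i)

/-- `α`-EF1 for chores. -/
def EF1Chores (n : ℕ) (α : ℝ) (c : Fin n → Finset ℕ → ℝ) (A : Fin n → Finset ℕ) : Prop :=
  ∀ i j : Fin n, (A i).Nonempty → ∃ e ∈ A i, c i ((A i).erase e) ≤ α * c i (A j)

/-- `α`-MMS (minimax share) for chores: for every `n`-partition `B` of the arrived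
chores, agent `i`'s cost is at most `α` times the maximum bundle cost of `B`
(i.e. at most `α` times the cost of some bundle of `B`); this says
`c i (A i) ≤ α · MMS_i`. -/
def MMSChores (n : ℕ) (α : ℝ) (c : Fin n → Finset ℕ → ℝ) (T : Finset ℕ)
    (A : Fin n → Finset ℕ) : Prop :=
  ∀ i : Fin n, ∀ B : Fin n → Finset ℕ, IsPartition n T B → ∃ j, c i (A i) ≤ α * c i (B j)

/-- `α`-min-USC: the utilitarian social cost of `A` is at most `α` times that of any
complete allocation of the arrived chores. -/
def MinUSC (n : ℕ) (α : ℝ) (c : Fin n → Finset ℕ → ℝ) (T : Finset ℕ)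
    (A : Fin n → Finset ℕ) : Prop :=
  ∀ B : Fin n → Finset ℕ, IsPartition n T B → ∑ i, c i (A i) ≤ α * ∑ i, c i (B i)

/-- The cost of each chore in the adversarial instance: the first chore costs `1` to both agents,
the second one costs `1 / 2` to agent `p` and `2` to the other agent, and all later ones cost `x`
to agent `p` and `y` to the other agent. -/
noncomputable def advCost (x y : ℝ) (p i : Fin 2) : ℕ → ℝ
  | 0 => 1
  | 1 => if i = p then 1 / 2 else 2
  | _ => if i = p then x else y

/-- The additive cost functions with singleton costs `advCost`. -/
noncomputable def advProfile (x y : ℝ) (p : Fin 2) : Fin 2 → Finset ℕ → ℝ :=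
  fun i S => ∑ e ∈ S, advCost x y p i e

theorem advProfile_additive (x y : ℝ) (p i : Fin 2) : AdditiveVal (advProfile x y p i) := by
  intro S
  simp [advProfile]

theorem advProfile_biValued {x y : ℝ} (hx : x = 1 / 2 ∨ x = 1) (hy : y = 1 ∨ y = 2)
    (p i : Fin 2) : BiValuedVal (advProfile x y p i) := by
  by_cases h : i = p
  · refine ⟨1 / 2, 1, by norm_num, by norm_num, fun e => ?_⟩
    rcases e with _ | _ | e <;> simp [advProfile, advCost, h]
    simpa using hx
  · refine ⟨1, 2, by norm_num, by norm_num, fun e => ?_⟩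
    rcases e with _ | _ | e <;> simp [advProfile, advCost, h]
    exact hy

/-- The first chore does not reveal the parameters of the adversarial instance. -/
theorem restrictVal_advProfile_zero (x y : ℝ) (p : Fin 2) :
    restrictVal (advProfile x y p) 0 = fun _ S => ∑ _e ∈ S ∩ range 1, (1 : ℝ) := by
  funext i S
  refine sum_congr rfl fun e he => ?_
  obtain rfl : e = 0 := by simpa using (mem_inter.mp he).2
  rfl

/-- Some agent `p` receives the first chore, and the instance can be built around that agent; the
remaining possibilities are that `p` also receives the second chore, or that the other agent does
and the third chore goes to either of them. -/
theorem exists_runChores_advProfile (alg : ChoresAlg 2) (x y : ℝ) :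
    ∃ p q : Fin 2, q ≠ p ∧
      ((runChores alg (advProfile x y p) 2 p = {0, 1}
          ∧ runChores alg (advProfile x y p) 2 q = ∅) ∨
        (runChores alg (advProfile x y p) 3 p = {0, 2}
          ∧ runChores alg (advProfile x y p) 3 q = {1}) ∨
        (runChores alg (advProfile x y p) 3 p = {0}
          ∧ runChores alg (advProfile x y p) 3 q = {1, 2})) := by
  obtain ⟨p, hp⟩ : ∃ p, alg 0 (fun _ S => ∑ _e ∈ S ∩ range 1, (1 : ℝ)) = p := ⟨_, rfl⟩
  obtain ⟨q, hq⟩ : ∃ q : Fin 2, q ≠ p := exists_ne p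
  have two (r : Fin 2) : r = p ∨ r = q := by omega
  refine ⟨p, q, hq, ?_⟩
  have h0 : alg 0 (restrictVal (advProfile x y p) 0) = p := by
    rw [restrictVal_advProfile_zero, hp]
  rcases two (alg 1 (restrictVal (advProfile x y p) 1)) with h1 | h1
  · left
    simp [runChores, h0, h1, hq, pair_comm]
  · rcases two (alg 2 (restrictVal (advProfile x y p) 2)) with h2 | h2
    · right; left
      simp [runChores, h0, h1, h2, hq, hq.symm, pair_comm]
    · right; right
      simp [runChores, h0, h1, h2, hq, hq.symm, pair_comm]

theorem not_EF1Chores_of_pair {n : ℕ} {α : ℝ} {c : Fin n → Finset ℕ → ℝ}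
    {A : Fin n → Finset ℕ} {i j : Fin n} {a b : ℕ} (hab : a ≠ b) (hA : A i = {a, b})
    (ha : α * c i (A j) < c i {a}) (hb : α * c i (A j) < c i {b}) : ¬ EF1Chores n α c A := by
  intro h
  obtain ⟨e, he, hle⟩ := h i j (by simp [hA])
  rw [hA] at he hle
  rcases mem_insert.mp he with rfl | he
  · rw [erase_insert (by simpa using hab)] at hle
    exact hb.not_ge hle
  · obtain rfl := mem_singleton.mp he
    rw [pair_comm, erase_insert (by simpa using hab.symm)] at hle
    exact ha.not_ge hle

theorem not_MMSChores_of_sdiff {α : ℝ} {c : Fin 2 → Finset ℕ → ℝ} {T : Finset ℕ}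
    {A : Fin 2 → Finset ℕ} (i : Fin 2) {B : Finset ℕ} (hB : B ⊆ T)
    (h₁ : α * c i B < c i (A i)) (h₂ : α * c i (T \ B) < c i (A i)) :
    ¬ MMSChores 2 α c T A := by
  intro h
  obtain ⟨j, hj⟩ := h i ![B, T \ B] <| by
    refine ⟨⟨?_, ?_⟩, fun e he => ?_⟩
    · simp [Fin.forall_fin_two, hB]
    · simp [Fin.forall_fin_two, disjoint_sdiff, sdiff_disjoint]
    · by_cases heB : e ∈ B <;> simp [Fin.exists_fin_two, he, heB]
  fin_cases j
  · exact h₁.not_ge hj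
  · exact h₂.not_ge hj

/-- for two agents with additive bi-valued cost functions, no
deterministic online chores algorithm guarantees a complete allocation that is
`(2-ε)`-EF1, and none guarantees one that is `(3/2-ε)`-MMS. -/
theorem chores_biValued_lower_bounds :
    (∀ ε : ℝ, 0 < ε → ε ≤ 1 →
      ∀ alg : ChoresAlg 2,
      ∃ (t : ℕ) (c : Fin 2 → Finset ℕ → ℝ),
        (∀ i, AdditiveVal (c i)) ∧ (∀ i, BiValuedVal (c i)) ∧
        ¬ EF1Chores 2 (2 - ε) c (runChores alg c t)) ∧
    (∀ ε : ℝ, 0 < ε → ε ≤ 1 / 2 →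
      ∀ alg : ChoresAlg 2,
      ∃ (t : ℕ) (c : Fin 2 → Finset ℕ → ℝ),
        (∀ i, AdditiveVal (c i)) ∧ (∀ i, BiValuedVal (c i)) ∧
        ¬ MMSChores 2 (3 / 2 - ε) c (Finset.range t) (runChores alg c t)) := by
  constructor
  · intro ε hε _ alg
    obtain ⟨p, q, hq, h⟩ := exists_runChores_advProfile alg 1 2
    have additive := advProfile_additive 1 2 p
    have biValued := advProfile_biValued (x := 1) (y := 2) (by simp) (by simp) p
    rcases h with ⟨hP, hQ⟩ | ⟨hP, hQ⟩ | ⟨hP, hQ⟩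
    · refine ⟨2, _, additive, biValued, not_EF1Chores_of_pair (j := q) (by simp) hP ?_ ?_⟩ <;>
        simp [hQ, advProfile, advCost]
    · refine ⟨3, _, additive, biValued, not_EF1Chores_of_pair (j := q) (by simp) hP ?_ ?_⟩ <;>
        simp [hQ, advProfile, advCost] <;> linarith
    · refine ⟨3, _, additive, biValued, not_EF1Chores_of_pair (j := p) (by simp) hQ ?_ ?_⟩ <;>
        simp [hP, hq, advProfile, advCost] <;> linarith
  · intro ε hε _ alg
    obtain ⟨p, q, hq, h⟩ := exists_runChores_advProfile alg (1 / 2) 1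
    have additive := advProfile_additive (1 / 2) 1 p
    have biValued := advProfile_biValued (x := 1 / 2) (y := 1) (by simp) (by simp) p
    have sdiff₂ : range 2 \ {0} = {1} := by decide
    have sdiff₃ : range 3 \ {0} = {1, 2} := by decide
    have sdiff₃' : range 3 \ {1} = {0, 2} := by decide
    rcases h with ⟨hP, hQ⟩ | ⟨hP, hQ⟩ | ⟨hP, hQ⟩
    · refine ⟨2, _, additive, biValued,
        not_MMSChores_of_sdiff p (B := {0}) (by simp) ?_ ?_⟩ <;>
        (rw [hP]; simp [sdiff₂, advProfile, advCost]; linarith)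
    · refine ⟨3, _, additive, biValued,
        not_MMSChores_of_sdiff p (B := {0}) (by simp) ?_ ?_⟩ <;>
        (rw [hP]; simp [sdiff₃, advProfile, advCost]; linarith)
    · refine ⟨3, _, additive, biValued,
        not_MMSChores_of_sdiff q (B := {1}) (by simp) ?_ ?_⟩ <;>
        (rw [hQ]; simp [hq, sdiff₃', advProfile, advCost]; linarith)

end OnlineFair
end

section
/- For every γ ≥ 1, every β ∈ [1,2), and every deterministic online algorithm for chores, there exists a chores instance with two agents having additive bi-valued cost functions such that the final complete allocation A^t produced by the algorithm is not γ-min-USC, or it fails α-EF1 for every α ≥ 1 and fails β-MMS. In particular, no deterministic online algorithm can compute a complete allocation that is α-EF1 or β-MMS and simultaneously γ-min-USC, for any α, γ ≥ 1 and β < 2, even for two agents with additive bi-valued cost functions. -/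
open Finset

namespace OnlineFair

/-- Unit cost for every chore and agent, except that chore `1` costs the agent other
than `j` the amount `r`. -/
noncomputable def unitCostExcept (r : ℝ) (j i : Fin 2) (S : Finset ℕ) : ℝ :=
  ∑ e ∈ S, if i ≠ j ∧ e = 1 then r else 1

lemma unitCostExcept_additive (r : ℝ) (j i : Fin 2) :
    AdditiveVal (unitCostExcept r j i) := by
  intro S
  simp [unitCostExcept]

lemma unitCostExcept_biValued {r : ℝ} (hr : 1 ≤ r) (j i : Fin 2) :
    BiValuedVal (unitCostExcept r j i) := by
  refine ⟨1, r, one_pos, hr, fun e => ?_⟩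
  simp only [unitCostExcept, sum_singleton]
  split_ifs <;> simp

lemma unitCostExcept_self (r : ℝ) (j : Fin 2) (S : Finset ℕ) :
    unitCostExcept r j j S = #S := by
  simp [unitCostExcept]

/-- In the first round all these cost profiles look the same. -/
lemma restrictVal_unitCostExcept_zero (r : ℝ) (j : Fin 2) :
    restrictVal (unitCostExcept r j) 0 = fun _ S => (#(S ∩ range 1) : ℝ) := by
  funext i S
  rw [restrictVal, unitCostExcept, Finset.sum_congr rfl (g := fun _ => (1 : ℝ))]
  · simp
  · intro e he
    have : e ≠ 1 := by
      have := (mem_inter.mp he).2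
      simp at this
      omega
    simp [this]

lemma isPartition_all_to (n : ℕ) (T : Finset ℕ) (j : Fin n) :
    IsPartition n T (fun i => if i = j then T else ∅) := by
  refine ⟨⟨fun i => ?_, fun i k hik => ?_⟩, fun e he => ⟨j, by simpa using he⟩⟩
  · dsimp only
    split_ifs <;> simp
  · dsimp only
    split_ifs with hi hk
    · exact absurd (hi.trans hk.symm) hik
    all_goals simp

lemma isPartition_singletons (n : ℕ) :
    IsPartition n (range n) (fun i => {(i : ℕ)}) := by
  refine ⟨⟨fun i => by simp, fun i k hik => ?_⟩, fun e he => ?_⟩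
  · simpa [Fin.ext_iff] using hik
  · exact ⟨⟨e, by simpa using he⟩, by simp⟩

/-- for two agents with additive bi-valued cost functions, no
deterministic online chores algorithm computes a complete allocation that is `α`-EF1
or `β`-MMS and simultaneously `γ`-min-USC, for any `α, γ ≥ 1` and `1 ≤ β < 2`. -/
theorem chores_biValued_no_fair_and_efficient :
    ∀ γ : ℝ, 1 ≤ γ → ∀ β : ℝ, 1 ≤ β → β < 2 →
    ∀ alg : ChoresAlg 2,
    ∃ (t : ℕ) (c : Fin 2 → Finset ℕ → ℝ),
      (∀ i, AdditiveVal (c i)) ∧ (∀ i, BiValuedVal (c i)) ∧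
      (¬ MinUSC 2 γ c (Finset.range t) (runChores alg c t) ∨
        ((∀ α : ℝ, 1 ≤ α → ¬ EF1Chores 2 α c (runChores alg c t)) ∧
          ¬ MMSChores 2 β c (Finset.range t) (runChores alg c t))) := by
  intro γ hγ β _ hβ alg
  set j := alg 0 (fun _ S => (#(S ∩ range 1) : ℝ)) with hj
  set c := unitCostExcept (2 * γ) j with hc
  have first : alg 0 (restrictVal c 0) = j := by
    rw [hc, restrictVal_unitCostExcept_zero]
  refine ⟨2, c, unitCostExcept_additive _ j, unitCostExcept_biValued (by linarith) j, ?_⟩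
  by_cases second : alg 1 (restrictVal c 1) = j
  · right
    have run : runChores alg c 2 = fun i => if i = j then range 2 else ∅ := by
      funext i
      simp only [runChores, first, second]
      split_ifs
      · decide
      · rfl
    rw [run]
    constructor
    · intro α _ hEF
      obtain ⟨k, hk⟩ := exists_ne j
      obtain ⟨e, he, hle⟩ := hEF j k (by simp)
      simp only [if_true, if_neg hk] at he hle
      rw [hc, unitCostExcept_self, unitCostExcept_self, card_erase_of_mem he] at hle
      norm_num at hle
    · intro hMMS
      obtain ⟨k, hk⟩ := hMMS j _ (isPartition_singletons 2)
      simp only [if_true] at hk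
      rw [hc, unitCostExcept_self, unitCostExcept_self] at hk
      norm_num at hk
      linarith
  · left
    intro hUSC
    have h := hUSC _ (isPartition_all_to 2 (range 2) j)
    have run : runChores alg c 2 = fun i => if i = j then {0} else {1} := by
      funext i
      have : i = alg 1 (restrictVal c 1) ↔ i ≠ j := by omega
      simp only [runChores, first, this]
      split_ifs <;> simp_all
    rw [run] at h
    obtain hj0 | hj1 : j = 0 ∨ j = 1 := by omega
    · simp [hc, hj0, unitCostExcept, Fin.sum_univ_two] at h
      linarith
    · simp [hc, hj1, unitCostExcept, Fin.sum_univ_two] at h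
      linarith

end OnlineFair
end

section
/- For every γ ≥ 1 and every deterministic online algorithm for chores, there exists a chores instance with two agents, where agent 1 has an additive binary cost function and agent 2 has an additive bi-valued cost function, such that the final complete allocation A^t produced by the algorithm is not γ-min-USC, or it fails α-EF1 for every α ≥ 1 and fails 1-MMS. In particular, no deterministic online algorithm can compute a complete allocation that is α-EF1 or MMS and simultaneously γ-min-USC for any α, γ ≥ 1 in this setting. -/
open Finset

namespace OnlineFair

/-- for two agents, one with an additive binary cost function and one
with an additive bi-valued cost function, no deterministic online chores algorithm
computes a complete allocation that is `α`-EF1 or MMS and simultaneously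
`γ`-min-USC, for any `α, γ ≥ 1`. -/
theorem chores_binary_biValued_no_efficiency :
    ∀ γ : ℝ, 1 ≤ γ →
    ∀ alg : ChoresAlg 2,
    ∃ (t : ℕ) (c : Fin 2 → Finset ℕ → ℝ),
      AdditiveVal (c 0) ∧ BinaryVal (c 0) ∧ AdditiveVal (c 1) ∧ BiValuedVal (c 1) ∧
      (¬ MinUSC 2 γ c (Finset.range t) (runChores alg c t) ∨
        ((∀ α : ℝ, 1 ≤ α → ¬ EF1Chores 2 α c (runChores alg c t)) ∧
          ¬ MMSChores 2 1 c (Finset.range t) (runChores alg c t))) := by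
  intro γ hγ alg
  have hγ0 : 0 < γ := by linarith
  set ε : ℝ := 1 / (4 * γ) with hε
  have hε0 : 0 < ε := by positivity
  have hγε : γ * (ε * 2) = 1 / 2 := by rw [hε]; field_simp; norm_num
  set c : Fin 2 → Finset ℕ → ℝ := ![fun S => (S.card : ℝ), fun S => ε * S.card] with hc
  have hc0 : ∀ S, c 0 S = (S.card : ℝ) := fun _ => rfl
  have hc1 : ∀ S, c 1 S = ε * S.card := fun _ => rfl
  refine ⟨2, c, fun S => by simp [hc0], fun e => by simp [hc0], fun S => ?_,
    ⟨ε, ε, hε0, le_rfl, fun e => by simp [hc1]⟩, ?_⟩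
  · simp [hc1, mul_comm]
  by_cases hall : alg 0 (restrictVal c 0) = 1 ∧ alg 1 (restrictVal c 1) = 1
  · -- agent `1` receives both chores
    right
    obtain ⟨h0, h1⟩ := hall
    have hA0 : runChores alg c 2 0 = ∅ := by simp [runChores, h0, h1]
    have hA1 : runChores alg c 2 1 = {1, 0} := by simp [runChores, h0, h1]
    constructor
    · intro α _ hEF
      obtain ⟨e, he, hle⟩ := hEF 1 0 (by simp [hA1])
      rw [hc1, hc1, Finset.card_erase_of_mem he, hA0, hA1] at hle
      norm_num at hle
      linarith
    · intro hM
      obtain ⟨j, hj⟩ := hM 1 ![{0}, {1}] (by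
        refine ⟨⟨?_, ?_⟩, ?_⟩
        · simp [Fin.forall_fin_two]
        · simp [Fin.forall_fin_two]
        · intro e he
          have : e < 2 := Finset.mem_range.mp he
          interval_cases e <;> simp [Fin.exists_fin_two])
      rw [hA1, hc1, hc1] at hj
      fin_cases j <;> norm_num at hj <;> linarith
  · -- agent `0` receives a chore, while leaving both to agent `1` is much cheaper
    left
    intro hU
    have hne : (runChores alg c 2 0).Nonempty := by
      by_cases h1 : alg 1 (restrictVal c 1) = 1
      · have h0 : alg 0 (restrictVal c 0) = 0 := by
          have := fun h => hall ⟨h, h1⟩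
          omega
        exact ⟨0, by simp [runChores, h0, h1]⟩
      · have h1' : alg 1 (restrictVal c 1) = 0 := by omega
        exact ⟨1, by simp [runChores, h1']⟩
    have hcard : (1 : ℝ) ≤ (runChores alg c 2 0).card := by
      exact_mod_cast hne.card_pos
    have h := hU ![∅, Finset.range 2] (by
      refine ⟨⟨?_, ?_⟩, ?_⟩
      · simp [Fin.forall_fin_two]
      · simp [Fin.forall_fin_two]
      · exact fun e he => ⟨1, he⟩)
    have hpos : 0 ≤ ε * (runChores alg c 2 1).card := by positivity
    simp only [Fin.sum_univ_two, hc0, hc1] at h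
    simp only [Matrix.cons_val_zero, Matrix.cons_val_one, Finset.card_empty,
      Finset.card_range, Nat.cast_zero, zero_add, Nat.cast_ofNat, hγε] at h
    linarith

end OnlineFair
end

section
/- Let n agents have additive cost functions over a finite sequence of distinct chores e_1,…,e_T, and suppose the instance is monotone: either c_i({e_1}) ≤ c_i({e_2}) ≤ … ≤ c_i({e_T}) for every agent i, or c_i({e_1}) ≥ c_i({e_2}) ≥ … ≥ c_i({e_T}) for every agent i. Then the round-robin allocation, which assigns chore e_k to agent ((k−1) mod n)+1 for each k, yields after every round k a complete allocation that is 1-EF1. -/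
open Finset

namespace OnlineFair

/-- The round-robin allocation of chores `0, …, k-1` among `n` agents:
chore `e` goes to agent `e % n`. -/
def roundRobin (n k : ℕ) : Fin n → Finset ℕ :=
  fun i => (Finset.range k).filter (fun e => e % n = (i : ℕ))

theorem sum_le_sum_of_injOn_of_le {ι : Type*} [DecidableEq ι] {S R : Finset ι} {g : ι → ℝ}
    (f : ι → ι) (hg : ∀ e, 0 ≤ g e) (hmaps : ∀ e ∈ S, f e ∈ R) (hinj : Set.InjOn f S)
    (hle : ∀ e ∈ S, g e ≤ g (f e)) : ∑ e ∈ S, g e ≤ ∑ e ∈ R, g e :=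
  calc ∑ e ∈ S, g e ≤ ∑ e ∈ S, g (f e) := Finset.sum_le_sum hle
    _ = ∑ e ∈ S.image f, g e := (Finset.sum_image hinj).symm
    _ ≤ ∑ e ∈ R, g e :=
      Finset.sum_le_sum_of_subset_of_nonneg (Finset.image_subset_iff.2 hmaps) fun e _ _ => hg e

/-- Every residue class is reached from any other by a forward shift of length less than `n`. -/
theorem exists_shift_mod_eq {n : ℕ} (i j : Fin n) :
    ∃ d < n, ∀ e : ℕ, e % n = i → (e + d) % n = j := by
  refine ⟨(j + (n - i)) % n, Nat.mod_lt _ i.pos, fun e he => ?_⟩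
  rw [Nat.add_mod_mod, Nat.add_mod, he, Nat.add_mod_mod,
    show (i : ℕ) + (j + (n - i)) = j + n by omega, Nat.add_mod_right, Nat.mod_eq_of_lt j.isLt]

/-- Every residue class is reached from any other by a backward shift of length less than `n`. -/
theorem exists_sub_shift_mod_eq {n : ℕ} (i j : Fin n) :
    ∃ d < n, ∀ e : ℕ, d ≤ e → e % n = i → (e - d) % n = j := by
  obtain ⟨d, hd, h⟩ := exists_shift_mod_eq j i
  refine ⟨d, hd, fun e hde he => ?_⟩
  have hmod : (e - d) + d ≡ j + d [MOD n] := by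
    rw [Nat.ModEq, Nat.sub_add_cancel hde, he, h j (Nat.mod_eq_of_lt j.isLt)]
  exact Eq.trans (Nat.ModEq.add_right_cancel' d hmod) (Nat.mod_eq_of_lt j.isLt)

theorem add_le_of_mod_eq_of_lt {n a b : ℕ} (h : a % n = b % n) (hlt : a < b) : a + n ≤ b := by
  have hdvd : n ∣ b - a := (Nat.modEq_iff_dvd' hlt.le).1 h
  have := Nat.le_of_dvd (by omega) hdvd
  omega

theorem mem_roundRobin {n k e : ℕ} {i : Fin n} :
    e ∈ roundRobin n k i ↔ e < k ∧ e % n = i := by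
  simp [roundRobin]

theorem complete_roundRobin {n : ℕ} (hn : 0 < n) (k : ℕ) :
    Complete n (Finset.range k) (roundRobin n k) := fun e he =>
  ⟨⟨e % n, Nat.mod_lt e hn⟩, mem_roundRobin.2 ⟨Finset.mem_range.1 he, rfl⟩⟩

/-- With nondecreasing costs, dropping the last chore of a bundle removes all envy. -/
theorem sum_erase_max'_roundRobin_le {n k : ℕ} {g : ℕ → ℝ} (hg : ∀ e, 0 ≤ g e)
    (hmono : ∀ s t, s ≤ t → t < k → g s ≤ g t) (i j : Fin n)
    (hi : (roundRobin n k i).Nonempty) :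
    ∑ e ∈ (roundRobin n k i).erase ((roundRobin n k i).max' hi), g e ≤
      ∑ e ∈ roundRobin n k j, g e := by
  obtain ⟨d, hd, hshift⟩ := exists_shift_mod_eq i j
  obtain ⟨hmk, hmi⟩ := mem_roundRobin.1 (Finset.max'_mem _ hi)
  have key : ∀ e ∈ (roundRobin n k i).erase ((roundRobin n k i).max' hi),
      e + d < k ∧ e % n = i := fun e he => by
    have hlt := Finset.lt_max'_of_mem_erase_max' _ hi he
    have hei := (mem_roundRobin.1 (Finset.mem_of_mem_erase he)).2
    have := add_le_of_mod_eq_of_lt (hei.trans hmi.symm) hlt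
    exact ⟨by omega, hei⟩
  exact sum_le_sum_of_injOn_of_le (· + d) hg
    (fun e he => mem_roundRobin.2 ⟨(key e he).1, hshift e (key e he).2⟩)
    (add_left_injective d).injOn
    (fun e he => hmono _ _ (Nat.le_add_right e d) (key e he).1)

/-- With nonincreasing costs, dropping the first chore of a bundle removes all envy. -/
theorem sum_erase_min'_roundRobin_le {n k : ℕ} {g : ℕ → ℝ} (hg : ∀ e, 0 ≤ g e)
    (hanti : ∀ s t, s ≤ t → t < k → g t ≤ g s) (i j : Fin n)
    (hi : (roundRobin n k i).Nonempty) :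
    ∑ e ∈ (roundRobin n k i).erase ((roundRobin n k i).min' hi), g e ≤
      ∑ e ∈ roundRobin n k j, g e := by
  obtain ⟨d, hd, hshift⟩ := exists_sub_shift_mod_eq i j
  obtain ⟨-, hmi⟩ := mem_roundRobin.1 (Finset.min'_mem _ hi)
  have key : ∀ e ∈ (roundRobin n k i).erase ((roundRobin n k i).min' hi),
      d ≤ e ∧ e < k ∧ e % n = i := fun e he => by
    have hlt := Finset.min'_lt_of_mem_erase_min' _ hi he
    have hei := mem_roundRobin.1 (Finset.mem_of_mem_erase he)
    have := add_le_of_mod_eq_of_lt (hmi.trans hei.2.symm) hlt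
    exact ⟨by omega, hei⟩
  refine sum_le_sum_of_injOn_of_le (· - d) hg (fun e he => ?_) (fun a ha b hb hab => ?_)
    (fun e he => hanti _ _ (Nat.sub_le e d) (key e he).2.1)
  · obtain ⟨hde, hek, hei⟩ := key e he
    exact mem_roundRobin.2 ⟨(Nat.sub_le e d).trans_lt hek, hshift e hde hei⟩
  · have := (key a ha).1
    have := (key b hb).1
    dsimp only at hab
    omega

/-- for additive cost functions on a monotone instance (all agents'
singleton costs are nondecreasing along the arrival order, or all are nonincreasing),
the round-robin allocation is, after every round, a complete allocation that is EF1. -/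
theorem chores_roundRobin_monotone_EF1 :
    ∀ n : ℕ, 0 < n →
    ∀ (T : ℕ) (c : Fin n → Finset ℕ → ℝ),
      (∀ i, AdditiveVal (c i)) →
      (∀ (i : Fin n) (e : ℕ), 0 ≤ c i {e}) →
      ((∀ (i : Fin n) (s t : ℕ), s ≤ t → t < T → c i {s} ≤ c i {t}) ∨
        (∀ (i : Fin n) (s t : ℕ), s ≤ t → t < T → c i {t} ≤ c i {s})) →
      ∀ k : ℕ, k ≤ T →
        Complete n (Finset.range k) (roundRobin n k) ∧
        EF1Chores n 1 c (roundRobin n k) := by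
  intro n hn T c hadd hnonneg hmon k hk
  refine ⟨complete_roundRobin hn k, fun i j hi => ?_⟩
  simp only [one_mul, hadd i (roundRobin n k j)]
  rcases hmon with hmono | hanti
  · refine ⟨_, Finset.max'_mem _ hi, ?_⟩
    rw [hadd i]
    exact sum_erase_max'_roundRobin_le (hnonneg i)
      (fun s t hst ht => hmono i s t hst (ht.trans_le hk)) i j hi
  · refine ⟨_, Finset.min'_mem _ hi, ?_⟩
    rw [hadd i]
    exact sum_erase_min'_roundRobin_le (hnonneg i)
      (fun s t hst ht => hanti i s t hst (ht.trans_le hk)) i j hi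

end OnlineFair
end
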